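/- Let N ≥ 1, s ∈ (0,2), p ≥ 2 a real number, and θ ∈ S(ℝ^N). Then ∫_{ℝ^N} |θ(x)|^{p−2} θ(x) Λ^s θ(x) dx ≥ (2/p) ∫_{ℝ^N} |ξ|^s |F(|θ|^{p/2})(ξ)|² dξ ≥ 0, where F denotes the Fourier transform (the middle quantity equals (2/p)‖Λ^{s/2}(|θ|^{p/2})‖²_{L²}). -/

import Mathlib

open MeasureTheory Filter Topology SchwartzMap
open scoped ENNReal FourierTransform

/-- The fractional Laplacian `Λ^s` of order `0 < s < 2` with constant `c`, defined through the
symmetrized singular integral. -/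
noncomputable def fracLapSI (N : ℕ) (c s : ℝ) (f : EuclideanSpace ℝ (Fin N) → ℝ)
    (x : EuclideanSpace ℝ (Fin N)) : ℝ :=
  (c / 2) * ∫ y : EuclideanSpace ℝ (Fin N),
    (2 * f x - f (x + y) - f (x - y)) / ‖y‖ ^ ((N : ℝ) + s)

section Plancherel

variable {V : Type*} [NormedAddCommGroup V] [InnerProductSpace ℝ V] [FiniteDimensional ℝ V]
  [MeasurableSpace V] [BorelSpace V]

/-- The Fourier integral of an `L¹ ∩ L²` function represents its `L²` Fourier transform. -/
theorem fourier_ae_eq_fourier_toLp {h : V → ℂ} (h1 : Integrable h) (h2 : MemLp h 2) :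
    𝓕 h =ᵐ[volume] (𝓕 (h2.toLp h) : Lp ℂ 2 (volume : Measure V)) := by
  have hcont : Continuous (𝓕 h) := VectorFourier.fourierIntegral_continuous
    Real.continuous_fourierChar (L := innerₗ V) continuous_inner h1
  refine ae_eq_of_integral_contDiff_smul_eq hcont.locallyIntegrable
    ((Lp.memLp _).locallyIntegrable (by norm_num)) fun g hg hgs ↦ ?_
  have hg' : HasCompactSupport (fun x ↦ (g x : ℂ)) :=
    hgs.comp_left (g := ((↑) : ℝ → ℂ)) Complex.ofReal_zero
  let ψ : 𝓢(V, ℂ) := hg'.toSchwartzMap (Complex.ofRealCLM.contDiff.comp hg)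
  have hψ : ∀ x, ψ x = (g x : ℂ) := fun x ↦ rfl
  have e1 := VectorFourier.integral_fourierIntegral_smul_eq_flip (L := innerₗ V)
    Real.continuous_fourierChar continuous_inner ψ.integrable h1 (μ := volume) (ν := volume)
  have e2 : (𝓕 (h2.toLp h : 𝓢'(V, ℂ))) ψ
      = Lp.toTemperedDistribution (𝓕 (h2.toLp h)) ψ := by
    rw [Lp.fourier_toTemperedDistribution_eq]
  rw [TemperedDistribution.fourier_apply, Lp.toTemperedDistribution_apply,
    Lp.toTemperedDistribution_apply] at e2
  have e3 : ∫ x, (𝓕 ψ) x • (h2.toLp h) x = ∫ x, (𝓕 ψ) x • h x := by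
    refine integral_congr_ae ?_
    filter_upwards [h2.coeFn_toLp] with x hx
    rw [hx]
  simp only [flip_innerₗ] at e1
  calc ∫ x, g x • 𝓕 h x = ∫ x, ψ x • 𝓕 h x := by simp [hψ]
    _ = ∫ x, (𝓕 ψ) x • h x := e1.symm
    _ = ∫ x, ψ x • (𝓕 (h2.toLp h) : Lp ℂ 2 (volume : Measure V)) x := by rw [← e3, e2]
    _ = _ := by simp [hψ]

/-- Plancherel's theorem for `L¹ ∩ L²` functions. -/
theorem lintegral_enorm_fourier_sq {h : V → ℂ} (h1 : Integrable h) (h2 : MemLp h 2) :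
    ∫⁻ ξ, ‖𝓕 h ξ‖ₑ ^ 2 = ∫⁻ x, ‖h x‖ₑ ^ 2 := by
  have e : eLpNorm (𝓕 h) 2 volume = eLpNorm h 2 volume := by
    rw [eLpNorm_congr_ae (fourier_ae_eq_fourier_toLp h1 h2), ← eLpNorm_congr_ae h2.coeFn_toLp,
      ← Lp.enorm_def, ← Lp.enorm_def, ← ofReal_norm, ← ofReal_norm, Lp.norm_fourier_eq]
  simp only [eLpNorm_eq_lintegral_rpow_enorm_toReal two_ne_zero ENNReal.ofNat_ne_top] at e
  simpa using ENNReal.rpow_left_injective (by norm_num) e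

end Plancherel

section GagliardoSymbol

variable {V : Type*} [NormedAddCommGroup V] [InnerProductSpace ℝ V] [FiniteDimensional ℝ V]
  [MeasurableSpace V] [BorelSpace V]

/-- The Fourier symbol of the Gagliardo seminorm with kernel `‖y‖ ^ (-a)`. -/
noncomputable def gagliardoSymbol (a : ℝ) (ξ : V) : ℝ≥0∞ :=
  ∫⁻ y : V, ENNReal.ofReal (‖y‖ ^ a)⁻¹ * ‖(Real.fourierChar (inner ℝ y ξ) : ℂ) - 1‖ₑ ^ 2

theorem lintegral_comp_smul_of_pos (f : V → ℝ≥0∞) {r : ℝ} (hr : 0 < r) :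
    ∫⁻ x, f (r • x) = ENNReal.ofReal (r ^ Module.finrank ℝ V)⁻¹ * ∫⁻ x, f x := by
  have e := (Homeomorph.smul (isUnit_iff_ne_zero.2 hr.ne').unit
    (α := V)).measurableEmbedding.lintegral_map f (μ := volume)
  have e' : Measure.map (fun x : V ↦ r • x) volume = _ :=
    Measure.map_addHaar_smul volume hr.ne'
  change ∫⁻ a, f a ∂(Measure.map (fun x : V ↦ r • x) volume) = ∫⁻ x, f (r • x) at e
  rw [← e, e', lintegral_smul_measure, abs_of_pos (by positivity), smul_eq_mul]

theorem gagliardoSymbol_smul (a : ℝ) (ξ : V) {r : ℝ} (hr : 0 < r) :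
    gagliardoSymbol a (r • ξ)
      = ENNReal.ofReal (r ^ (a - Module.finrank ℝ V)) * gagliardoSymbol a ξ := by
  have h1 : ∀ y : V, ENNReal.ofReal (‖y‖ ^ a)⁻¹ *
      ‖(Real.fourierChar (inner ℝ y (r • ξ)) : ℂ) - 1‖ₑ ^ 2 = ENNReal.ofReal (r ^ a) *
      (ENNReal.ofReal (‖r • y‖ ^ a)⁻¹ *
        ‖(Real.fourierChar (inner ℝ (r • y) ξ) : ℂ) - 1‖ₑ ^ 2) := by
    intro y
    rw [real_inner_smul_right, real_inner_smul_left, ← mul_assoc,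
      ← ENNReal.ofReal_mul (by positivity), norm_smul, Real.norm_of_nonneg hr.le,
      Real.mul_rpow hr.le (norm_nonneg _), mul_inv, ← mul_assoc,
      mul_inv_cancel₀ (by positivity), one_mul]
  unfold gagliardoSymbol
  simp_rw [h1]
  rw [lintegral_const_mul' _ _ ENNReal.ofReal_ne_top, lintegral_comp_smul_of_pos (fun y ↦
    ENNReal.ofReal (‖y‖ ^ a)⁻¹ * ‖(Real.fourierChar (inner ℝ y ξ) : ℂ) - 1‖ₑ ^ 2) hr, ← mul_assoc,
    ← ENNReal.ofReal_mul (by positivity), Real.rpow_sub hr, Real.rpow_natCast, div_eq_mul_inv]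

theorem gagliardoSymbol_map (a : ℝ) (ξ : V) (e : V ≃ₗᵢ[ℝ] V) :
    gagliardoSymbol a (e ξ) = gagliardoSymbol a ξ := by
  unfold gagliardoSymbol
  rw [← e.measurePreserving.lintegral_comp_emb e.toHomeomorph.measurableEmbedding]
  simp

theorem gagliardoSymbol_eq_of_norm_eq (a : ℝ) {ξ η : V} (h : ‖ξ‖ = ‖η‖) :
    gagliardoSymbol a ξ = gagliardoSymbol a η := by
  rw [← Submodule.reflection_sub h, gagliardoSymbol_map]

theorem gagliardoSymbol_eq (a : ℝ) (u : V) (hu : ‖u‖ = 1) {ξ : V} (hξ : ξ ≠ 0) :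
    gagliardoSymbol a ξ
      = ENNReal.ofReal (‖ξ‖ ^ (a - Module.finrank ℝ V)) * gagliardoSymbol a u := by
  rw [← gagliardoSymbol_smul a u (norm_pos_iff.2 hξ)]
  exact gagliardoSymbol_eq_of_norm_eq a (by simp [norm_smul, hu])

/-- The Gagliardo seminorm of an `L¹ ∩ L²` function on the Fourier side. -/
theorem lintegral_gagliardo (a : ℝ) {h : V → ℂ} (h1 : Integrable h) (h2 : MemLp h 2) :
    ∫⁻ y : V, ENNReal.ofReal (‖y‖ ^ a)⁻¹ * ∫⁻ x, ‖h (x + y) - h x‖ₑ ^ 2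
      = ∫⁻ ξ, ‖𝓕 h ξ‖ₑ ^ 2 * gagliardoSymbol a ξ := by
  have hcont : Continuous (𝓕 h) := VectorFourier.fourierIntegral_continuous
    Real.continuous_fourierChar (L := innerₗ V) continuous_inner h1
  have key : ∀ y : V, ∫⁻ x, ‖h (x + y) - h x‖ₑ ^ 2
      = ∫⁻ ξ, ‖𝓕 h ξ‖ₑ ^ 2 * ‖(Real.fourierChar (inner ℝ y ξ) : ℂ) - 1‖ₑ ^ 2 := by
    intro y
    have i1 : Integrable (fun x ↦ h (x + y)) := h1.comp_add_right y
    have i2 : MemLp (fun x ↦ h (x + y)) 2 :=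
      h2.comp_measurePreserving (measurePreserving_add_right volume y)
    refine (lintegral_enorm_fourier_sq (i1.sub h1) (i2.sub h2)).symm.trans ?_
    refine lintegral_congr fun ξ ↦ ?_
    have e1 : 𝓕 (fun x ↦ h (x + y) - h x) ξ = 𝓕 (fun x ↦ h (x + y)) ξ - 𝓕 h ξ := by
      simp only [Real.fourier_eq, smul_sub]
      exact integral_sub ((Real.fourierIntegral_convergent_iff ξ).2 i1)
        ((Real.fourierIntegral_convergent_iff ξ).2 h1)
    have e2 : 𝓕 (fun x ↦ h (x + y)) ξ = (Real.fourierChar (inner ℝ y ξ) : ℂ) * 𝓕 h ξ :=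
      congrFun (VectorFourier.fourierIntegral_comp_add_right Real.fourierChar volume (innerₗ V) h y)
        ξ
    change ‖𝓕 (fun x ↦ h (x + y) - h x) ξ‖ₑ ^ 2 = _
    rw [e1, e2, ← sub_one_mul, enorm_mul, mul_pow, mul_comm]
  simp_rw [key]
  unfold gagliardoSymbol
  have hm1 : Measurable fun ξ ↦ ‖𝓕 h ξ‖ₑ ^ 2 := hcont.enorm.measurable.pow_const 2
  have hm2 : Measurable fun z : V × V ↦
      ‖(Real.fourierChar (inner ℝ z.1 z.2) : ℂ) - 1‖ₑ ^ 2 := by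
    have : Continuous fun z : V × V ↦ (Real.fourierChar (inner ℝ z.1 z.2) : ℂ) - 1 :=
      (continuous_subtype_val.comp (Real.continuous_fourierChar.comp continuous_inner)).sub
        continuous_const
    exact this.enorm.measurable.pow_const 2
  have hm3 : Measurable fun y : V ↦ ENNReal.ofReal (‖y‖ ^ a)⁻¹ := by fun_prop
  simp_rw [← lintegral_const_mul' _ _ ENNReal.ofReal_ne_top]
  rw [lintegral_lintegral_swap]
  · refine lintegral_congr fun ξ ↦ ?_
    rw [← lintegral_const_mul' _ _ (ENNReal.pow_ne_top enorm_ne_top)]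
    exact lintegral_congr fun y ↦ by ring
  · have hm4 : Measurable fun z : V × V ↦ ENNReal.ofReal (‖z.1‖ ^ a)⁻¹ :=
      hm3.comp measurable_fst
    have hm5 : Measurable fun z : V × V ↦ ‖𝓕 h z.2‖ₑ ^ 2 := hm1.comp measurable_snd
    exact (hm4.mul (hm5.mul hm2)).aemeasurable

end GagliardoSymbol

section SecondDifference

variable {V : Type*} [NormedAddCommGroup V] [InnerProductSpace ℝ V]

theorem SchwartzMap.exists_norm_le (f : 𝓢(V, ℝ)) : ∃ C, 0 ≤ C ∧ ∀ x, |f x| ≤ C := by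
  obtain ⟨C, hC0, hC⟩ := f.decay 0 0
  exact ⟨C, hC0.le, fun x ↦ by simpa using hC x⟩

theorem SchwartzMap.exists_secondDiff_le (f : 𝓢(V, ℝ)) :
    ∃ C, ∀ x y, |2 * f x - f (x + y) - f (x - y)| ≤ C * min 1 (‖y‖ ^ 2) := by
  obtain ⟨C, hC0, hC⟩ := f.exists_norm_le
  obtain ⟨M, hM0, hM⟩ := f.decay 0 2
  have hd : ContDiff ℝ 2 f := f.smooth 2
  have hdf : Differentiable ℝ f := hd.differentiable (by norm_num)
  have hd' : Differentiable ℝ (fderiv ℝ f) :=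
    (hd.fderiv_right (m := 1) (by norm_num)).differentiable (by norm_num)
  have hM' : ∀ x, ‖fderiv ℝ (fderiv ℝ f) x‖ ≤ M := fun x ↦ by
    have := hM x
    rw [pow_zero, one_mul, ← norm_iteratedFDeriv_fderiv, ← norm_iteratedFDeriv_fderiv,
      norm_iteratedFDeriv_zero] at this
    exact this
  have hlip : ∀ x z, ‖fderiv ℝ f z - fderiv ℝ f x‖ ≤ M * ‖z - x‖ := fun x z ↦
    convex_univ.norm_image_sub_le_of_norm_fderiv_le (fun x _ ↦ hd' x) (fun x _ ↦ hM' x)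
      (Set.mem_univ _) (Set.mem_univ _)
  have hquad : ∀ x y, |2 * f x - f (x + y) - f (x - y)| ≤ 2 * M * ‖y‖ ^ 2 := by
    intro x y
    let u : V → ℝ := fun z ↦ f (x + z) + f (x - z)
    have hu : ∀ z, HasFDerivAt u (fderiv ℝ f (x + z) - fderiv ℝ f (x - z)) z := by
      intro z
      have h1 := (hdf (x + z)).hasFDerivAt.comp z ((hasFDerivAt_id z).const_add x)
      have h2 := (hdf (x - z)).hasFDerivAt.comp z ((hasFDerivAt_id z).const_sub x)
      convert! h1.add h2 using 1
      ext v
      simp [sub_eq_add_neg]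
    have hb : ∀ z ∈ Metric.closedBall (0 : V) ‖y‖,
        ‖fderiv ℝ f (x + z) - fderiv ℝ f (x - z)‖ ≤ 2 * M * ‖y‖ := by
      intro z hz
      have hz' : ‖z‖ ≤ ‖y‖ := by simpa using hz
      have e : x + z - (x - z) = (2 : ℝ) • z := by rw [two_smul]; abel
      have h3 := hlip (x - z) (x + z)
      rw [e, norm_smul, Real.norm_two] at h3
      nlinarith
    have := (convex_closedBall (0 : V) ‖y‖).norm_image_sub_le_of_norm_hasFDerivWithin_le
      (fun z _ ↦ (hu z).hasFDerivWithinAt) hb (x := 0) (y := y) (by simp) (by simp)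
    rw [sub_zero, Real.norm_eq_abs, abs_sub_comm] at this
    simp only [u, add_zero, sub_zero] at this
    convert! this using 1
    · congr 1; ring
    · ring
  refine ⟨max (4 * C) (2 * M), fun x y ↦ ?_⟩
  rcases min_choice 1 (‖y‖ ^ 2) with h | h <;> rw [h]
  · rw [mul_one]
    refine le_trans ?_ (le_max_left _ _)
    have h1 := abs_le.1 (hC x)
    have h2 := abs_le.1 (hC (x + y))
    have h3 := abs_le.1 (hC (x - y))
    rw [abs_le]
    constructor <;> linarith
  · exact (hquad x y).trans (by gcongr; exact le_max_right _ _)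

variable [FiniteDimensional ℝ V] [MeasurableSpace V] [BorelSpace V]

theorem integrable_min_one_norm_sq_div [Nontrivial V] {s : ℝ} (hs0 : 0 < s) (hs2 : s < 2) :
    Integrable (fun y : V ↦ min 1 (‖y‖ ^ 2) / ‖y‖ ^ ((Module.finrank ℝ V : ℝ) + s)) := by
  have hd : 0 < Module.finrank ℝ V := Module.finrank_pos
  rw [integrable_fun_norm_addHaar volume
    (f := fun r : ℝ ↦ min 1 (r ^ 2) / r ^ ((Module.finrank ℝ V : ℝ) + s))]
  have key : ∀ r : ℝ, 0 < r → r ^ (Module.finrank ℝ V - 1) •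
      (min 1 (r ^ 2) / r ^ ((Module.finrank ℝ V : ℝ) + s)) = min 1 (r ^ 2) * r ^ (-1 - s) := by
    intro r hr
    have : r ^ (Module.finrank ℝ V - 1) = r ^ ((Module.finrank ℝ V : ℝ) - 1) := by
      rw [← Real.rpow_natCast, Nat.cast_sub hd, Nat.cast_one]
    rw [this, smul_eq_mul, mul_comm, div_mul_eq_mul_div, mul_div_assoc, ← Real.rpow_sub hr]
    congr 2; ring
  rw [← Set.Ioc_union_Ioi_eq_Ioi zero_le_one, integrableOn_union]
  constructor
  · refine IntegrableOn.congr_fun (f := fun r : ℝ ↦ r ^ (1 - s)) ?_ (fun r hr ↦ ?_)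
      measurableSet_Ioc
    · rw [← intervalIntegrable_iff_integrableOn_Ioc_of_le zero_le_one]
      exact intervalIntegral.intervalIntegrable_rpow' (by linarith)
    · have hr0 : 0 < r := hr.1
      dsimp only
      rw [key r hr0, min_eq_right (pow_le_one₀ hr0.le hr.2), ← Real.rpow_natCast,
        ← Real.rpow_add hr0]
      congr 1; push_cast; ring
  · refine IntegrableOn.congr_fun (f := fun r : ℝ ↦ r ^ (-1 - s)) ?_ (fun r hr ↦ ?_)
      measurableSet_Ioi
    · exact integrableOn_Ioi_rpow_of_lt (by linarith) one_pos
    · have hr1 : 1 < r := hr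
      dsimp only
      rw [key r (by linarith), min_eq_left (one_le_pow₀ hr1.le), one_mul]

/-- Symmetrization of the pairing of the singular integral of `θ` with a weight `w` that is
comonotone with `θ`. -/
theorem integral_mul_secondDiff [Nontrivial V] {s : ℝ} (hs0 : 0 < s) (hs2 : s < 2)
    (θ : 𝓢(V, ℝ)) {w : V → ℝ} (hwc : Continuous w) (hw : Integrable w)
    (hmono : ∀ x y, 0 ≤ (w x - w y) * (θ x - θ y)) :
    ENNReal.ofReal (∫ x, w x * ∫ y, (2 * θ x - θ (x + y) - θ (x - y)) /
        ‖y‖ ^ ((Module.finrank ℝ V : ℝ) + s))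
      = ∫⁻ y : V, ENNReal.ofReal (‖y‖ ^ ((Module.finrank ℝ V : ℝ) + s))⁻¹ *
          ∫⁻ x, ENNReal.ofReal ((w (x + y) - w x) * (θ (x + y) - θ x)) ∧
    0 ≤ ∫ x, w x * ∫ y, (2 * θ x - θ (x + y) - θ (x - y)) /
        ‖y‖ ^ ((Module.finrank ℝ V : ℝ) + s) := by
  set a : ℝ := (Module.finrank ℝ V : ℝ) + s
  obtain ⟨C, hC⟩ := θ.exists_secondDiff_le
  obtain ⟨B, hB0, hB⟩ := θ.exists_norm_le
  have hθc : Continuous θ := θ.continuous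
  let F : V × V → ℝ := fun z ↦ w z.1 * ((2 * θ z.1 - θ (z.1 + z.2) - θ (z.1 - z.2)) / ‖z.2‖ ^ a)
  have hFm : Measurable F := by
    have h1 : Continuous fun z : V × V ↦ 2 * θ z.1 - θ (z.1 + z.2) - θ (z.1 - z.2) := by fun_prop
    have h2 : Measurable fun z : V × V ↦ ‖z.2‖ ^ a := measurable_snd.norm.pow_const a
    exact (hwc.measurable.comp measurable_fst).mul (h1.measurable.div h2)
  have hF : Integrable F (volume.prod volume) := by
    refine (hw.mul_prod ((integrable_min_one_norm_sq_div hs0 hs2).const_mul C)).mono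
      hFm.aestronglyMeasurable (Filter.Eventually.of_forall fun z ↦ ?_)
    simp only [F, norm_mul, norm_div]
    rw [← mul_div_assoc ‖C‖, ← norm_mul]
    gcongr
    exact (hC z.1 z.2).trans (le_abs_self _)
  have hsymm : ∀ y, ∫ x, F (x, y)
      = (‖y‖ ^ a)⁻¹ * ∫ x, (w (x + y) - w x) * (θ (x + y) - θ x) := by
    intro y
    have i1 : ∀ v, Integrable fun x ↦ w x * θ (x + v) := fun v ↦
      hw.mul_bdd (c := B) (by fun_prop) (Filter.Eventually.of_forall fun x ↦ hB _)
    have i0 : Integrable fun x ↦ w x * θ x := by simpa using i1 0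
    have i1' : ∀ v, Integrable fun x ↦ w x * (θ x - θ (x + v)) := fun v ↦ by
      simpa only [mul_sub] using! i0.sub (i1 v)
    have i2 : Integrable fun x ↦ w (x + y) * (θ (x + y) - θ x) := by
      simpa using (i1' (-y)).comp_add_right y
    have e2 : ∫ x, w x * (θ x - θ (x + -y)) = ∫ x, w (x + y) * (θ (x + y) - θ x) := by
      rw [← integral_add_right_eq_self _ y]
      simp
    calc ∫ x, F (x, y)
        = ∫ x, (‖y‖ ^ a)⁻¹ * (w x * (θ x - θ (x + y)) + w x * (θ x - θ (x + -y))) := by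
          refine integral_congr_ae (Filter.Eventually.of_forall fun x ↦ ?_)
          simp only [F, ← sub_eq_add_neg]
          ring
      _ = (‖y‖ ^ a)⁻¹ * ((∫ x, w x * (θ x - θ (x + y))) +
            ∫ x, w (x + y) * (θ (x + y) - θ x)) := by
          rw [integral_const_mul, integral_add (i1' y) (i1' (-y)), e2]
      _ = _ := by
          rw [← integral_add (i1' y) i2]
          congr 2
          ext x
          ring
  have hint : ∀ y, Integrable fun x ↦ (w (x + y) - w x) * (θ (x + y) - θ x) := fun y ↦
    ((hw.comp_add_right y).sub hw).mul_bdd (c := B + B) (by fun_prop)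
      (Filter.Eventually.of_forall fun x ↦
        (norm_sub_le _ _).trans (add_le_add (hB _) (hB _)))
  have hnn : ∀ y, 0 ≤ ∫ x, F (x, y) := fun y ↦ by
    rw [hsymm]
    exact mul_nonneg (by positivity) (integral_nonneg fun x ↦ hmono _ _)
  have hswap : ∫ x, w x * ∫ y, (2 * θ x - θ (x + y) - θ (x - y)) / ‖y‖ ^ a
      = ∫ y, ∫ x, F (x, y) := by
    simp_rw [← integral_const_mul]
    exact integral_integral_swap hF
  rw [hswap]
  refine ⟨?_, integral_nonneg hnn⟩
  rw [ofReal_integral_eq_lintegral_ofReal hF.integral_prod_right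
    (Filter.Eventually.of_forall hnn)]
  refine lintegral_congr fun y ↦ ?_
  rw [hsymm, ENNReal.ofReal_mul (by positivity), ofReal_integral_eq_lintegral_ofReal (hint y)
    (Filter.Eventually.of_forall fun x ↦ hmono _ _)]

end SecondDifference

theorem finrank_add_eq (N : ℕ) (s : ℝ) :
    (Module.finrank ℝ (EuclideanSpace ℝ (Fin N)) : ℝ) + s = (N : ℝ) + s := by
  rw [finrank_euclideanSpace_fin]

theorem ofReal_norm_rpow_mul_gagliardoSymbol {V : Type*} [NormedAddCommGroup V]
    [InnerProductSpace ℝ V] [FiniteDimensional ℝ V] [MeasurableSpace V] [BorelSpace V]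
    {s : ℝ} (hs0 : 0 < s) (u : V) (hu : ‖u‖ = 1) (ξ : V) :
    gagliardoSymbol ((Module.finrank ℝ V : ℝ) + s) ξ
      = ENNReal.ofReal (‖ξ‖ ^ s) * gagliardoSymbol ((Module.finrank ℝ V : ℝ) + s) u := by
  rcases eq_or_ne ξ 0 with rfl | hξ
  · simp [gagliardoSymbol, Real.zero_rpow hs0.ne']
  · rw [gagliardoSymbol_eq _ u hu hξ, add_sub_cancel_left]

theorem integral_mul_fracLapSI (N : ℕ) (c s : ℝ) (f w : EuclideanSpace ℝ (Fin N) → ℝ) :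
    ∫ x, w x * fracLapSI N c s f x = (c / 2) * ∫ x, w x *
      ∫ y, (2 * f x - f (x + y) - f (x - y)) / ‖y‖ ^ ((N : ℝ) + s) := by
  rw [← integral_const_mul]
  refine integral_congr_ae (Filter.Eventually.of_forall fun x ↦ ?_)
  simp only [fracLapSI]
  ring

/-- A nonzero real Schwartz function, together with its complexification. -/
theorem exists_schwartz_ne_zero (N : ℕ) : ∃ (f : 𝓢(EuclideanSpace ℝ (Fin N), ℝ))
    (g : 𝓢(EuclideanSpace ℝ (Fin N), ℂ)), (∀ x, g x = (f x : ℂ)) ∧ g ≠ 0 := by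
  let b : ContDiffBump (0 : EuclideanSpace ℝ (Fin N)) := ⟨1, 2, one_pos, one_lt_two⟩
  have hb : HasCompactSupport (fun x ↦ (b x : ℂ)) :=
    b.hasCompactSupport.comp_left (g := ((↑) : ℝ → ℂ)) Complex.ofReal_zero
  refine ⟨b.hasCompactSupport.toSchwartzMap b.contDiff,
    hb.toSchwartzMap (Complex.ofRealCLM.contDiff.comp b.contDiff), fun x ↦ rfl, fun h ↦ ?_⟩
  have h0 := DFunLike.congr_fun h 0
  have h1 : b 0 = 1 := b.one_of_mem_closedBall (by simp [b])
  change ((b 0 : ℝ) : ℂ) = 0 at h0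
  simp [h1] at h0

/-- The Fourier multiplier property determines the constant of the singular integral. -/
theorem ofReal_mul_gagliardoSymbol_eq_one (N : ℕ) (hN : 1 ≤ N) (s : ℝ) (hs0 : 0 < s) (hs2 : s < 2)
    (c : ℝ) (hc : 0 < c)
    (hfourier : ∀ f : SchwartzMap (EuclideanSpace ℝ (Fin N)) ℝ,
      ∀ ξ : EuclideanSpace ℝ (Fin N),
        𝓕 (fun x => (fracLapSI N c s (⇑f) x : ℂ)) ξ
          = ((‖ξ‖ ^ s : ℝ) : ℂ) * 𝓕 (fun x => (f x : ℂ)) ξ)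
    (u : EuclideanSpace ℝ (Fin N)) (hu : ‖u‖ = 1) :
    ENNReal.ofReal (c / 2) * gagliardoSymbol ((N : ℝ) + s) u = 1 := by
  have : NeZero N := ⟨by omega⟩
  obtain ⟨f, g, hg, hg0⟩ := exists_schwartz_ne_zero N
  have hgf : (fun x ↦ (f x : ℂ)) = g := funext fun x ↦ (hg x).symm
  have hL := hfourier f
  rw [hgf, ← SchwartzMap.fourier_coe] at hL
  set T : EuclideanSpace ℝ (Fin N) → ℂ := fun x ↦ (fracLapSI N c s f x : ℂ) with hT
  have hne : ¬ ∀ᵐ ξ : EuclideanSpace ℝ (Fin N), ((‖ξ‖ ^ s : ℝ) : ℂ) * 𝓕 g ξ = 0 := by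
    intro h
    have h1 : (𝓕 g : 𝓢(EuclideanSpace ℝ (Fin N), ℂ)) =ᵐ[volume] fun _ ↦ (0 : ℂ) := by
      filter_upwards [h, Measure.ae_ne volume (0 : EuclideanSpace ℝ (Fin N))] with ξ h1 h2
      refine (mul_eq_zero.1 h1).resolve_left ?_
      have := norm_pos_iff.2 h2
      exact_mod_cast (Real.rpow_pos_of_pos this s).ne'
    have h2 := (Continuous.ae_eq_iff_eq volume (𝓕 g).continuous continuous_const).1 h1
    have h3 : (𝓕 g : 𝓢(EuclideanSpace ℝ (Fin N), ℂ)) = 0 := by ext ξ; exact congrFun h2 ξ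
    exact hg0 ((FourierTransform.fourierEquiv ℂ
      𝓢(EuclideanSpace ℝ (Fin N), ℂ)).map_eq_zero_iff.1 h3)
  have hTi : Integrable T := by
    by_contra hni
    refine hne (Filter.Eventually.of_forall fun ξ ↦ ?_)
    rw [← hL, Real.fourier_eq]
    exact integral_undef fun h ↦ hni ((Real.fourierIntegral_convergent_iff ξ).1 h)
  have hTc : Continuous (𝓕 T) := VectorFourier.fourierIntegral_continuous
    Real.continuous_fourierChar (L := innerₗ _) continuous_inner hTi
  have hparseval : ∫ ξ, innerSL ℂ (𝓕 T ξ) (𝓕 g ξ)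
      = ∫ x, innerSL ℂ (T x) (𝓕⁻ (𝓕 g : 𝓢(EuclideanSpace ℝ (Fin N), ℂ)) x) := by
    have h := VectorFourier.integral_sesq_fourierIntegral_eq_neg_flip
      (L := innerₗ (EuclideanSpace ℝ (Fin N))) (innerSL ℂ) Real.continuous_fourierChar
      continuous_inner hTi (𝓕 g).integrable (μ := volume) (ν := volume)
    rw [flip_innerₗ] at h
    rw [SchwartzMap.fourierInv_coe]
    exact h
  have hinner : ∀ ξ, innerSL ℂ (𝓕 T ξ) (𝓕 g ξ) = ((‖ξ‖ ^ s * ‖𝓕 g ξ‖ ^ 2 : ℝ) : ℂ) := by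
    intro ξ
    rw [hL, innerSL_apply_apply, RCLike.inner_apply, map_mul, Complex.conj_ofReal, mul_left_comm,
      Complex.mul_conj, Complex.normSq_eq_norm_sq, ← Complex.ofReal_mul]
  have hre : ∫ x, f x * fracLapSI N c s f x
      = ∫ ξ, ‖ξ‖ ^ s * ‖𝓕 g ξ‖ ^ 2 := by
    have hinner' : ∀ x, innerSL ℂ (T x) (g x) = ((f x * fracLapSI N c s f x : ℝ) : ℂ) := by
      intro x
      rw [innerSL_apply_apply, RCLike.inner_apply, hT, hg, Complex.conj_ofReal,
        Complex.ofReal_mul]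
    rw [FourierTransform.fourierInv_fourier_eq g] at hparseval
    simp_rw [hinner, hinner', integral_complex_ofReal] at hparseval
    exact_mod_cast hparseval.symm
  have hi : Integrable fun ξ ↦ ‖ξ‖ ^ s * ‖𝓕 g ξ‖ ^ 2 := by
    have h1 : Integrable fun ξ ↦ ‖𝓕 T ξ‖ * ‖𝓕 g ξ‖ :=
      (𝓕 g).integrable.norm.bdd_mul (c := ∫ x, ‖T x‖) hTc.norm.aestronglyMeasurable
        (Filter.Eventually.of_forall fun ξ ↦ by
          rw [norm_norm]
          exact VectorFourier.norm_fourierIntegral_le_integral_norm _ _ _ _ _)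
    refine h1.congr (Filter.Eventually.of_forall fun ξ ↦ ?_)
    simp only [hL, norm_mul, Complex.norm_real, Real.norm_eq_abs]
    rw [abs_of_nonneg (by positivity)]
    ring
  have hsym := integral_mul_secondDiff hs0 hs2 f f.continuous f.integrable
    fun x y ↦ mul_self_nonneg _
  rw [finrank_add_eq] at hsym
  set A := ∫⁻ ξ, ENNReal.ofReal (‖ξ‖ ^ s * ‖𝓕 g ξ‖ ^ 2) with hA
  have hA' : ENNReal.ofReal (∫ ξ, ‖ξ‖ ^ s * ‖𝓕 g ξ‖ ^ 2) = A :=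
    ofReal_integral_eq_lintegral_ofReal hi
      (Filter.Eventually.of_forall fun ξ ↦ by positivity)
  have hA_top : A ≠ ⊤ := hA' ▸ ENNReal.ofReal_ne_top
  have hA_zero : A ≠ 0 := by
    intro h0
    rw [hA, lintegral_eq_zero_iff' hi.aestronglyMeasurable.aemeasurable.ennreal_ofReal] at h0
    refine hne ?_
    filter_upwards [h0] with ξ h
    have h' : ‖ξ‖ ^ s * ‖𝓕 g ξ‖ ^ 2 = 0 :=
      le_antisymm (ENNReal.ofReal_eq_zero.1 h) (by positivity)
    rcases mul_eq_zero.1 h' with h | h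
    · rw [h]; simp
    · rw [norm_eq_zero.1 (pow_eq_zero_iff two_ne_zero |>.1 h), mul_zero]
  have key : A = ENNReal.ofReal (c / 2) * gagliardoSymbol ((N : ℝ) + s) u * A := by
    calc A = ENNReal.ofReal (c / 2) * ∫⁻ y : EuclideanSpace ℝ (Fin N),
          ENNReal.ofReal (‖y‖ ^ ((N : ℝ) + s))⁻¹ * ∫⁻ x, ‖g (x + y) - g x‖ₑ ^ 2 := by
          rw [← hA', ← hre, integral_mul_fracLapSI, ENNReal.ofReal_mul (by positivity), hsym.1]
          congr 1
          refine lintegral_congr fun y ↦ ?_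
          congr 1
          refine lintegral_congr fun x ↦ ?_
          rw [hg, hg, ← Complex.ofReal_sub, ← ofReal_norm, Complex.norm_real,
            ← ENNReal.ofReal_pow (norm_nonneg _), Real.norm_eq_abs, sq_abs, sq]
      _ = ENNReal.ofReal (c / 2) * (gagliardoSymbol ((N : ℝ) + s) u * A) := by
          rw [lintegral_gagliardo _ g.integrable (g.memLp 2)]
          congr 1
          rw [hA, ← lintegral_const_mul'' _ hi.aestronglyMeasurable.aemeasurable.ennreal_ofReal]
          refine lintegral_congr fun ξ ↦ ?_
          rw [← finrank_add_eq, ofReal_norm_rpow_mul_gagliardoSymbol hs0 u hu,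
            ENNReal.ofReal_mul (by positivity), ENNReal.ofReal_pow (norm_nonneg _), ofReal_norm,
            SchwartzMap.fourier_coe]
          ring
      _ = _ := (mul_assoc _ _ _).symm
  exact ((ENNReal.mul_eq_right hA_zero hA_top).1 key.symm)

section PowerInequality

theorem rpow_sub_two_mul_le {p : ℝ} (hp : 2 ≤ p) {a b : ℝ} (ha : 0 ≤ a) (hb : 0 ≤ b) :
    a ^ (p - 2) * (a * b) ≤ (1 - 2 / p) * a ^ p + 2 / p * (a ^ (p / 2) * b ^ (p / 2)) := by
  have hp0 : 0 < p := by linarith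
  have h := Real.geom_mean_le_arith_mean2_weighted (w₁ := 1 - 2 / p) (w₂ := 2 / p)
    (by rw [sub_nonneg, div_le_one hp0]; exact hp) (by positivity)
    (Real.rpow_nonneg ha p) (mul_nonneg (Real.rpow_nonneg ha (p / 2)) (Real.rpow_nonneg hb (p / 2)))
    (by ring)
  have e1 : (a ^ p) ^ (1 - 2 / p) = a ^ (p - 2) := by
    rw [← Real.rpow_mul ha]; congr 1; field_simp
  have e2 : (a ^ (p / 2) * b ^ (p / 2)) ^ (2 / p) = a * b := by
    rw [← Real.mul_rpow ha hb, ← Real.rpow_mul (mul_nonneg ha hb)]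
    have : p / 2 * (2 / p) = 1 := by field_simp
    rw [this, Real.rpow_one]
  rwa [e1, e2] at h

theorem abs_rpow_sub_two_mul_sq {p : ℝ} (hp : 2 ≤ p) (a : ℝ) :
    |a| ^ (p - 2) * a * a = |a| ^ p := by
  rcases eq_or_ne a 0 with rfl | ha
  · simp [Real.zero_rpow (by linarith : p ≠ 0)]
  · have h : 0 < |a| := abs_pos.2 ha
    rw [mul_assoc, ← abs_mul_abs_self a, ← sq, ← Real.rpow_natCast, ← Real.rpow_add h]
    congr 1; push_cast; ring

theorem abs_rpow_sub_two_mul_mul_le {p : ℝ} (hp : 2 ≤ p) (a b : ℝ) :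
    |a| ^ (p - 2) * a * b
      ≤ (1 - 2 / p) * |a| ^ p + 2 / p * (|a| ^ (p / 2) * |b| ^ (p / 2)) := by
  refine le_trans ?_ (rpow_sub_two_mul_le hp (abs_nonneg a) (abs_nonneg b))
  rw [mul_assoc]
  exact mul_le_mul_of_nonneg_left ((le_abs_self _).trans (abs_mul a b).le) (by positivity)

/-- The Stroock–Varopoulos inequality, with constant `2 / p`. -/
theorem stroock_varopoulos {p : ℝ} (hp : 2 ≤ p) (a b : ℝ) :
    2 / p * (|a| ^ (p / 2) - |b| ^ (p / 2)) ^ 2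
      ≤ (|a| ^ (p - 2) * a - |b| ^ (p - 2) * b) * (a - b) := by
  have hsq : ∀ t : ℝ, (|t| ^ (p / 2)) ^ 2 = |t| ^ p := fun t ↦ by
    rw [← Real.rpow_natCast, ← Real.rpow_mul (abs_nonneg t)]
    congr 1; push_cast; ring
  have h1 := abs_rpow_sub_two_mul_mul_le hp a b
  have h2 := abs_rpow_sub_two_mul_mul_le hp b a
  have h3 := abs_rpow_sub_two_mul_sq hp a
  have h4 := abs_rpow_sub_two_mul_sq hp b
  rw [sub_sq, hsq, hsq]
  linear_combination h1 + h2 - h3 - h4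

end PowerInequality

theorem memLp_abs_rpow {V : Type*} [NormedAddCommGroup V] [InnerProductSpace ℝ V]
    [FiniteDimensional ℝ V] [MeasurableSpace V] [BorelSpace V] (θ : 𝓢(V, ℝ)) {q : ℝ}
    (hq : 1 ≤ q) (r : ℝ≥0∞) : MemLp (fun x ↦ ((|θ x| ^ q : ℝ) : ℂ)) r := by
  obtain ⟨B, hB0, hB⟩ := θ.exists_norm_le
  have hc : Continuous fun x ↦ ((|θ x| ^ q : ℝ) : ℂ) :=
    Complex.continuous_ofReal.comp
      (θ.continuous.abs.rpow_const fun _ ↦ Or.inr (by linarith))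
  refine (θ.memLp r).of_le_mul (c := B ^ (q - 1)) hc.aestronglyMeasurable
    (Filter.Eventually.of_forall fun x ↦ ?_)
  rw [Complex.norm_real, Real.norm_of_nonneg (by positivity), Real.norm_eq_abs]
  calc |θ x| ^ q = |θ x| ^ (q - 1) * |θ x| := by
        rcases eq_or_ne (|θ x|) 0 with h | h
        · rw [h, Real.zero_rpow (by linarith), mul_zero]
        · rw [← Real.rpow_add_one h, sub_add_cancel]
    _ ≤ _ := by
        gcongr
        exact hB x

/-- Let `N ≥ 1`, `s ∈ (0,2)`, `p ≥ 2` real, and `θ ∈ S(ℝ^N)`.  Then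
`∫ |θ(x)|^{p−2} θ(x) Λ^s θ(x) dx ≥ (2/p) ∫ |ξ|^s |F(|θ|^{p/2})(ξ)|² dξ ≥ 0`,
where `F` denotes the Fourier transform and `c_{N,s} > 0` is the constant for which
`F(Λ^s f)(ξ) = |ξ|^s F f(ξ)` on the Schwartz space. -/
theorem statement3 (N : ℕ) (hN : 1 ≤ N) (s : ℝ) (hs0 : 0 < s) (hs2 : s < 2)
    (p : ℝ) (hp : 2 ≤ p) (c : ℝ) (hc : 0 < c)
    (hfourier : ∀ f : SchwartzMap (EuclideanSpace ℝ (Fin N)) ℝ,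
      ∀ ξ : EuclideanSpace ℝ (Fin N),
        𝓕 (fun x => (fracLapSI N c s (⇑f) x : ℂ)) ξ
          = ((‖ξ‖ ^ s : ℝ) : ℂ) * 𝓕 (fun x => (f x : ℂ)) ξ)
    (θ : SchwartzMap (EuclideanSpace ℝ (Fin N)) ℝ) :
    (2 / p) * ∫ ξ : EuclideanSpace ℝ (Fin N),
        ‖ξ‖ ^ s * ‖𝓕 (fun x => ((|θ x| ^ (p / 2) : ℝ) : ℂ)) ξ‖ ^ 2
      ≤ ∫ x : EuclideanSpace ℝ (Fin N), |θ x| ^ (p - 2) * θ x * fracLapSI N c s (⇑θ) x ∧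
    0 ≤ (2 / p) * ∫ ξ : EuclideanSpace ℝ (Fin N),
        ‖ξ‖ ^ s * ‖𝓕 (fun x => ((|θ x| ^ (p / 2) : ℝ) : ℂ)) ξ‖ ^ 2 := by
  have : NeZero N := ⟨by omega⟩
  have hp0 : 0 < p := by linarith
  refine ⟨?_, mul_nonneg (by positivity) (integral_nonneg fun ξ ↦ by positivity)⟩
  obtain ⟨u, hu⟩ := exists_norm_eq (EuclideanSpace ℝ (Fin N)) zero_le_one
  have hconst := ofReal_mul_gagliardoSymbol_eq_one N hN s hs0 hs2 c hc hfourier u hu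
  have h1 : MemLp (fun x ↦ ((|θ x| ^ (p / 2) : ℝ) : ℂ)) 1 :=
    memLp_abs_rpow θ (by linarith) 1
  have h2 : MemLp (fun x ↦ ((|θ x| ^ (p / 2) : ℝ) : ℂ)) 2 :=
    memLp_abs_rpow θ (by linarith) 2
  rw [memLp_one_iff_integrable] at h1
  set h : EuclideanSpace ℝ (Fin N) → ℂ := fun x ↦ ((|θ x| ^ (p / 2) : ℝ) : ℂ) with hh
  have hcont : Continuous (𝓕 h) := VectorFourier.fourierIntegral_continuous
    Real.continuous_fourierChar (L := innerₗ _) continuous_inner h1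
  have hwc : Continuous fun x ↦ |θ x| ^ (p - 2) * θ x :=
    (θ.continuous.abs.rpow_const fun _ ↦ Or.inr (by linarith)).mul θ.continuous
  obtain ⟨B, hB0, hB⟩ := θ.exists_norm_le
  have hw : Integrable fun x ↦ |θ x| ^ (p - 2) * θ x :=
    θ.integrable.bdd_mul (c := B ^ (p - 2))
      (θ.continuous.abs.rpow_const fun _ ↦ Or.inr (by linarith)).aestronglyMeasurable
      (Filter.Eventually.of_forall fun x ↦ by
        rw [Real.norm_of_nonneg (by positivity)]
        exact Real.rpow_le_rpow (abs_nonneg _) (hB x) (by linarith))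
  have hsym := integral_mul_secondDiff hs0 hs2 θ hwc hw fun x y ↦
    le_trans (by positivity) (stroock_varopoulos hp (θ x) (θ y))
  rw [finrank_add_eq] at hsym
  rw [integral_mul_fracLapSI, ← integral_const_mul, integral_eq_lintegral_of_nonneg_ae
    (Filter.Eventually.of_forall fun ξ ↦ by positivity)
    (by
      have : Continuous fun ξ : EuclideanSpace ℝ (Fin N) ↦ ‖ξ‖ ^ s :=
        continuous_norm.rpow_const fun _ ↦ Or.inr hs0.le
      exact (continuous_const.mul (this.mul (hcont.norm.pow 2))).aestronglyMeasurable)]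
  refine ENNReal.toReal_le_of_le_ofReal (mul_nonneg (by positivity) hsym.2) ?_
  rw [ENNReal.ofReal_mul (by positivity), hsym.1]
  calc ∫⁻ ξ, ENNReal.ofReal (2 / p * (‖ξ‖ ^ s * ‖𝓕 h ξ‖ ^ 2))
      = ENNReal.ofReal (c / 2) * (ENNReal.ofReal (2 / p) *
          ∫⁻ ξ, ‖𝓕 h ξ‖ₑ ^ 2 * gagliardoSymbol ((N : ℝ) + s) ξ) := by
        rw [← lintegral_const_mul' _ _ ENNReal.ofReal_ne_top,
          ← lintegral_const_mul' _ _ ENNReal.ofReal_ne_top]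
        refine lintegral_congr fun ξ ↦ ?_
        rw [← finrank_add_eq, ofReal_norm_rpow_mul_gagliardoSymbol hs0 u hu, finrank_add_eq,
          ENNReal.ofReal_mul (by positivity), ENNReal.ofReal_mul (by positivity),
          ENNReal.ofReal_pow (norm_nonneg _), ofReal_norm]
        rw [← one_mul (ENNReal.ofReal (2 / p) * _), ← hconst]
        ring
    _ = ENNReal.ofReal (c / 2) * ∫⁻ y : EuclideanSpace ℝ (Fin N),
          ENNReal.ofReal (‖y‖ ^ ((N : ℝ) + s))⁻¹ *
            ∫⁻ x, ENNReal.ofReal (2 / p) * ‖h (x + y) - h x‖ₑ ^ 2 := by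
        rw [← lintegral_gagliardo _ h1 h2, ← lintegral_const_mul' _ _ ENNReal.ofReal_ne_top]
        congr 1
        refine lintegral_congr fun y ↦ ?_
        rw [lintegral_const_mul' _ _ ENNReal.ofReal_ne_top, mul_left_comm]
    _ ≤ _ := by
        gcongr with y x
        rw [hh, ← Complex.ofReal_sub, ← ofReal_norm, Complex.norm_real,
            ← ENNReal.ofReal_pow (norm_nonneg _), Real.norm_eq_abs, sq_abs,
            ← ENNReal.ofReal_mul (by positivity)]
        exact ENNReal.ofReal_le_ofReal (stroock_varopoulos hp _ _)
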